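/- Let V be a real inner product space, let d ≥ 2 be an integer, let e_1, …, e_d be an orthonormal family in V, and let h* be a unit vector in span{e_1, …, e_d}. Let ε be a real number with 0 < ε ≤ 5/18. Set v_1 = e_1, and suppose v_2, …, v_d are unit vectors in V such that for each j = 1, …, d−1: (i) v_{j+1} ∈ span{v_j, e_{j+1}}; (ii) the orthogonal projection P_j of h* onto span{v_j, e_{j+1}} is nonzero; and (iii) ‖v_{j+1} − P_j/‖P_j‖‖ ≤ ε. Then ‖v_d − h*‖ ≤ 5·(d−1)·ε. -/

import Mathlib

/-- A unit vector in the plane spanned by the orthonormal pair `x, y` that is `ε`-close to the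
direction of the projection `p` of `h` captures `h` almost as well as that projection. -/
theorem inner_sq_ge_of_near_normalized_projection {V : Type*} [NormedAddCommGroup V]
    [InnerProductSpace ℝ V] {h x y p w : V} {ε : ℝ} (hε1 : ε ^ 2 / 2 ≤ 1)
    (hx : ‖x‖ = 1) (hy : ‖y‖ = 1) (hxy : inner ℝ x y = 0) (hw : ‖w‖ = 1)
    (hp : p ∈ Submodule.span ℝ {x, y}) (hproj : h - p ∈ (Submodule.span ℝ {x, y})ᗮ)
    (hp0 : p ≠ 0) (hwmem : w ∈ Submodule.span ℝ {x, y}) (hclose : ‖w - ‖p‖⁻¹ • p‖ ≤ ε) :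
    0 ≤ inner ℝ w h ∧
      (1 - ε ^ 2 / 2) ^ 2 * (inner ℝ x h ^ 2 + inner ℝ y h ^ 2) ≤ inner ℝ w h ^ 2 := by
  have inner_eq : ∀ z ∈ Submodule.span ℝ {x, y}, inner ℝ z h = inner ℝ z p := by
    intro z hz
    have := Submodule.inner_right_of_mem_orthogonal hz hproj
    rw [inner_sub_right] at this
    linarith
  have hpos : 0 < ‖p‖ := norm_pos_iff.mpr hp0
  have norm_sq : ‖p‖ ^ 2 = inner ℝ x h ^ 2 + inner ℝ y h ^ 2 := by
    rw [inner_eq x (Submodule.subset_span (by simp)), inner_eq y (Submodule.subset_span (by simp))]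
    obtain ⟨a, b, rfl⟩ := Submodule.mem_span_pair.mp hp
    rw [← real_inner_self_eq_norm_sq]
    simp only [inner_add_left, inner_add_right, inner_smul_left, inner_smul_right, hxy,
      real_inner_comm x y, real_inner_self_eq_norm_sq, hx, hy, RCLike.conj_to_real]
    ring
  have key : (1 - ε ^ 2 / 2) * ‖p‖ ≤ inner ℝ w h := by
    have hsq : ‖w - ‖p‖⁻¹ • p‖ ^ 2 ≤ ε ^ 2 := by gcongr
    have hu : ‖‖p‖⁻¹ • p‖ = 1 := norm_smul_inv_norm hp0
    rw [norm_sub_sq_real, hw, hu, inner_smul_right] at hsq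
    rw [inner_eq w hwmem]
    have : 1 - ε ^ 2 / 2 ≤ ‖p‖⁻¹ * inner ℝ w p := by linarith
    rwa [inv_mul_eq_div, le_div_iff₀ hpos] at this
  have hq : 0 ≤ (1 - ε ^ 2 / 2) * ‖p‖ := mul_nonneg (by linarith) hpos.le
  refine ⟨hq.trans key, ?_⟩
  rw [← norm_sq, ← mul_pow]
  gcongr

/-- Parseval's identity for a vector in the span of a finite orthonormal family. -/
theorem Orthonormal.sum_sq_inner_eq_norm_sq {ι V : Type*} [Fintype ι] [NormedAddCommGroup V]
    [InnerProductSpace ℝ V] {e : ι → V} (he : Orthonormal ℝ e) {h : V}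
    (hh : h ∈ Submodule.span ℝ (Set.range e)) : ∑ i, inner ℝ (e i) h ^ 2 = ‖h‖ ^ 2 := by
  obtain ⟨c, rfl⟩ := (Submodule.mem_span_range_iff_exists_fun ℝ).mp hh
  rw [← real_inner_self_eq_norm_sq, he.inner_sum]
  simp [he.inner_right_fintype, sq]


theorem stmt13 {V : Type*} [NormedAddCommGroup V] [InnerProductSpace ℝ V]
    (d : ℕ) (hd : 2 ≤ d)
    (e : ℕ → V) (horth : Orthonormal ℝ (fun i : Fin d => e i))
    (hstar : V) (hstarnorm : ‖hstar‖ = 1)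
    (hstarspan : hstar ∈ Submodule.span ℝ (Set.range fun i : Fin d => e i))
    (ε : ℝ) (hε0 : 0 < ε) (hε : ε ≤ 5 / 18)
    (v : ℕ → V) (hvnorm : ∀ j < d, ‖v j‖ = 1) (hv0 : v 0 = e 0)
    (P : ℕ → V)
    (hPmem : ∀ j, j + 1 < d → P j ∈ Submodule.span ℝ {v j, e (j + 1)})
    (hPproj : ∀ j, j + 1 < d →
      hstar - P j ∈ (Submodule.span ℝ {v j, e (j + 1)})ᗮ)
    (hPne : ∀ j, j + 1 < d → P j ≠ 0)
    (hvmem : ∀ j, j + 1 < d → v (j + 1) ∈ Submodule.span ℝ {v j, e (j + 1)})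
    (hvclose : ∀ j, j + 1 < d → ‖v (j + 1) - ‖P j‖⁻¹ • P j‖ ≤ ε) :
    ‖v (d - 1) - hstar‖ ≤ 5 * (d - 1 : ℝ) * ε := by
  have hnorm : ∀ i < d, ‖e i‖ = 1 := fun i hi => horth.1 ⟨i, hi⟩
  have hinner : ∀ i j, i < d → j < d → i ≠ j → inner ℝ (e i) (e j) = 0 := fun i j hi hj hij =>
    horth.2 (i := ⟨i, hi⟩) (j := ⟨j, hj⟩) (by simpa using hij)
  have hperp : ∀ j i, j < i → i < d → inner ℝ (v j) (e i) = 0 := by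
    intro j
    induction j with
    | zero =>
      intro i hi hid
      rw [hv0]
      exact hinner 0 i (by omega) hid (by omega)
    | succ j ih =>
      intro i hi hid
      obtain ⟨a, b, hab⟩ := Submodule.mem_span_pair.mp (hvmem j (by omega))
      rw [← hab, inner_add_left, inner_smul_left, inner_smul_left, ih i (by omega) hid,
        hinner (j + 1) i (by omega) hid (by omega)]
      simp
  have hε2 : ε ^ 2 / 2 ≤ 1 := by nlinarith
  have hstep : ∀ j, j + 1 < d → 0 ≤ inner ℝ (v (j + 1)) hstar ∧
      (1 - ε ^ 2 / 2) ^ 2 * (inner ℝ (v j) hstar ^ 2 + inner ℝ (e (j + 1)) hstar ^ 2) ≤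
        inner ℝ (v (j + 1)) hstar ^ 2 := fun j hj =>
    inner_sq_ge_of_near_normalized_projection hε2 (hvnorm j (by omega)) (hnorm _ hj)
      (hperp j _ (by omega) hj) (hvnorm _ hj) (hPmem j hj) (hPproj j hj) (hPne j hj)
      (hvmem j hj) (hvclose j hj)
  have hq0 : 0 ≤ 1 - ε ^ 2 / 2 := by linarith
  have hq1 : 1 - ε ^ 2 / 2 ≤ 1 := by nlinarith [sq_nonneg ε]
  have hlower : ∀ j < d, ((1 - ε ^ 2 / 2) ^ j) ^ 2 *
      ∑ i ∈ Finset.range (j + 1), inner ℝ (e i) hstar ^ 2 ≤ inner ℝ (v j) hstar ^ 2 := by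
    intro j
    induction j with
    | zero => simp [hv0]
    | succ j ih =>
      intro hj
      refine le_trans ?_ (hstep j hj).2
      have hpow : ((1 - ε ^ 2 / 2) ^ j) ^ 2 ≤ 1 := pow_le_one₀ (by positivity) (pow_le_one₀ hq0 hq1)
      rw [Finset.sum_range_succ, pow_succ _ j, mul_pow, mul_comm (_ ^ 2), mul_assoc, mul_add]
      gcongr
      · exact ih (by omega)
      · exact mul_le_of_le_one_left (sq_nonneg _) hpow
  obtain ⟨n, rfl⟩ : ∃ n, d = n + 2 := ⟨d - 2, by omega⟩
  have hparseval := horth.sum_sq_inner_eq_norm_sq hstarspan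
  rw [Fin.sum_univ_eq_sum_range (fun i => inner ℝ (e i) hstar ^ 2), hstarnorm] at hparseval
  have hlast := hlower (n + 1) (by omega)
  rw [hparseval, one_pow, mul_one] at hlast
  have hcos : (1 - ε ^ 2 / 2) ^ (n + 1) ≤ inner ℝ (v (n + 1)) hstar :=
    (sq_le_sq₀ (by positivity) (hstep n (by omega)).1).mp hlast
  have hbernoulli := one_add_mul_le_pow (a := -(ε ^ 2 / 2)) (by linarith) (n + 1)
  rw [← sub_eq_add_neg] at hbernoulli
  have hdist := norm_sub_sq_real (v (n + 1)) hstar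
  rw [hvnorm (n + 1) (by omega), hstarnorm] at hdist
  push_cast at hbernoulli ⊢
  have hn : (0 : ℝ) ≤ n := n.cast_nonneg
  have hrhs : 0 ≤ 5 * ((n : ℝ) + 2 - 1) * ε := mul_nonneg (by linarith) hε0.le
  refine (sq_le_sq₀ (norm_nonneg _) hrhs).mp ?_
  calc ‖v (n + 1) - hstar‖ ^ 2 ≤ ((n : ℝ) + 1) * ε ^ 2 := by linarith
    _ ≤ (25 * ((n : ℝ) + 1) ^ 2) * ε ^ 2 := by
      gcongr
      nlinarith
    _ = (5 * ((n : ℝ) + 2 - 1) * ε) ^ 2 := by ring
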